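/- Let σ be a permutation of Fin n and let (τ₁,…,τ_r) and (τ′₁,…,τ′_r) be two lists of transpositions, both of length r = N(σ) and both with product equal to σ. Then the two lists are connected by standard moves. (The geodesic PMQ S_n^geo is coconnected.) -/

import Mathlib

/-- Word-length norm of a permutation with respect to the set of all transpositions:
the least `m` such that `σ` is a product of `m` transpositions. -/
noncomputable def permNorm {n : ℕ} (σ : Equiv.Perm (Fin n)) : ℕ :=
  sInf {m | ∃ l : List (Equiv.Perm (Fin n)), (∀ τ ∈ l, τ.IsSwap) ∧ l.prod = σ ∧ l.length = m}

/-- A single standard move on a list of elements of a group: an adjacent pair `(a, b)`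
is replaced by `(b, b⁻¹ * a * b)` or by `(a * b * a⁻¹, a)`. -/
def StandardMove {G : Type*} [Group G] (l l' : List G) : Prop :=
  ∃ (l₁ l₂ : List G) (a b : G),
    l = l₁ ++ a :: b :: l₂ ∧
    (l' = l₁ ++ b :: (b⁻¹ * a * b) :: l₂ ∨ l' = l₁ ++ (a * b * a⁻¹) :: a :: l₂)

/-- Two lists are connected by standard moves. -/
def StdConnected {G : Type*} [Group G] : List G → List G → Prop :=
  Relation.ReflTransGen StandardMove

namespace StandardMove

variable {G : Type*} [Group G] {l l' : List G}

theorem cons (c : G) (h : StandardMove l l') : StandardMove (c :: l) (c :: l') := by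
  obtain ⟨l₁, l₂, a, b, rfl, rfl | rfl⟩ := h
  · exact ⟨c :: l₁, l₂, a, b, rfl, Or.inl rfl⟩
  · exact ⟨c :: l₁, l₂, a, b, rfl, Or.inr rfl⟩

theorem length_eq (h : StandardMove l l') : l'.length = l.length := by
  obtain ⟨l₁, l₂, a, b, rfl, rfl | rfl⟩ := h <;> simp

theorem prod_eq (h : StandardMove l l') : l'.prod = l.prod := by
  obtain ⟨l₁, l₂, a, b, rfl, rfl | rfl⟩ := h <;> simp [mul_assoc]

end StandardMove

namespace StdConnected

variable {G : Type*} [Group G] {l l' : List G}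

theorem cons (c : G) (h : StdConnected l l') : StdConnected (c :: l) (c :: l') :=
  Relation.ReflTransGen.lift (List.cons c) (fun _ _ => StandardMove.cons c) _ _ h

theorem length_eq (h : StdConnected l l') : l'.length = l.length := by
  induction h with
  | refl => rfl
  | tail _ h ih => exact h.length_eq.trans ih

theorem prod_eq (h : StdConnected l l') : l'.prod = l.prod := by
  induction h with
  | refl => rfl
  | tail _ h ih => exact h.prod_eq.trans ih

theorem swap_right (a b : G) (l : List G) :
    StdConnected (a :: b :: l) (b :: (b⁻¹ * a * b) :: l) :=
  Relation.ReflTransGen.single ⟨[], l, a, b, rfl, Or.inl rfl⟩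

theorem swap_left (a b : G) (l : List G) :
    StdConnected (a :: b :: l) ((a * b * a⁻¹) :: a :: l) :=
  Relation.ReflTransGen.single ⟨[], l, a, b, rfl, Or.inr rfl⟩

end StdConnected

namespace Equiv.Perm

theorem IsSwap.conj {α : Type*} [DecidableEq α] {τ : Perm α} (h : τ.IsSwap) (g : Perm α) :
    (g * τ * g⁻¹).IsSwap := by
  obtain ⟨x, y, hxy, rfl⟩ := h
  exact ⟨g x, g y, g.injective.ne hxy, (swap_apply_apply g x y).symm⟩

variable {α : Type*} [Finite α] [DecidableEq α] {ρ : Perm α} {a b x y : α}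

theorem SameCycle.swap_mul_of_not (h : ¬ ρ.SameCycle a b) : (swap a b * ρ).SameCycle a b := by
  have key (j : ℕ) : (swap a b * ρ).SameCycle a ((ρ ^ j) a) := by
    induction j with
    | zero => exact SameCycle.refl _ _
    | succ j ih =>
      have hb : (ρ ^ (j + 1)) a ≠ b := fun e => h ⟨(j + 1 : ℕ), by rwa [zpow_natCast]⟩
      by_cases ha : (ρ ^ (j + 1)) a = a
      · rw [ha]
      · have e : (swap a b * ρ) ((ρ ^ j) a) = (ρ ^ (j + 1)) a := by
          rw [pow_succ', mul_apply] at *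
          rw [mul_apply, swap_apply_of_ne_of_ne ha hb]
        rw [← e]
        exact sameCycle_apply_right.2 ih
  have hρ : ρ.SameCycle a (ρ⁻¹ a) := ⟨-1, by simp⟩
  obtain ⟨j, hj⟩ := hρ.exists_nat_pow_eq
  have := sameCycle_apply_right.2 (key j)
  simpa [hj] using this

theorem SameCycle.of_swap_mul (h : (swap a b * ρ).SameCycle x y) :
    ρ.SameCycle x y ∨ ρ.SameCycle x a ∧ ρ.SameCycle y b ∨
      ρ.SameCycle x b ∧ ρ.SameCycle y a := by
  obtain ⟨j, rfl⟩ := h.exists_nat_pow_eq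
  clear h
  induction j with
  | zero => exact Or.inl (SameCycle.refl _ _)
  | succ j ih =>
    rw [pow_succ', mul_apply]
    generalize ((swap a b * ρ) ^ j) x = z at ih
    rw [mul_apply]
    have hz : ρ.SameCycle z (ρ z) := sameCycle_apply_right.2 (SameCycle.refl _ _)
    by_cases ha : ρ z = a
    · rw [ha, swap_apply_left]
      rw [ha] at hz
      have hb : ρ.SameCycle b b := SameCycle.refl _ _
      rcases ih with h | ⟨h, h'⟩ | ⟨h, h'⟩
      · exact Or.inr (Or.inl ⟨h.trans hz, hb⟩)
      · exact Or.inr (Or.inl ⟨h, hb⟩)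
      · exact Or.inl h
    by_cases hb : ρ z = b
    · rw [hb, swap_apply_right]
      rw [hb] at hz
      have ha : ρ.SameCycle a a := SameCycle.refl _ _
      rcases ih with h | ⟨h, h'⟩ | ⟨h, h'⟩
      · exact Or.inr (Or.inr ⟨h.trans hz, ha⟩)
      · exact Or.inl h
      · exact Or.inr (Or.inr ⟨h, ha⟩)
    · rw [swap_apply_of_ne_of_ne ha hb]
      simpa only [sameCycle_apply_left, sameCycle_apply_right] using ih

theorem SameCycle.swap_mul_of_disjoint (h : ρ.SameCycle x y) (ha : ¬ ρ.SameCycle x a)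
    (hb : ¬ ρ.SameCycle x b) : (swap a b * ρ).SameCycle x y := by
  obtain ⟨j, rfl⟩ := h.exists_nat_pow_eq
  clear h
  induction j with
  | zero => exact SameCycle.refl _ _
  | succ j ih =>
    have hx : ρ.SameCycle x ((ρ ^ (j + 1)) x) := ⟨(j + 1 : ℕ), by rw [zpow_natCast]⟩
    have e : (swap a b * ρ) ((ρ ^ j) x) = (ρ ^ (j + 1)) x := by
      rw [pow_succ', mul_apply] at *
      rw [mul_apply, swap_apply_of_ne_of_ne]
      · rintro e; exact ha (e ▸ hx)
      · rintro e; exact hb (e ▸ hx)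
    rw [← e]
    exact sameCycle_apply_right.2 ih

end Equiv.Perm

open Equiv Equiv.Perm

theorem StandardMove.isSwap {α : Type*} [DecidableEq α] {l l' : List (Perm α)}
    (h : StandardMove l l') (hl : ∀ τ ∈ l, τ.IsSwap) : ∀ τ ∈ l', τ.IsSwap := by
  obtain ⟨l₁, l₂, a, b, rfl, rfl | rfl⟩ := h
  · have := (hl a (by simp)).conj b⁻¹
    rw [inv_inv] at this
    simp only [List.mem_append, List.mem_cons] at hl ⊢
    grind
  · have := (hl b (by simp)).conj a
    simp only [List.mem_append, List.mem_cons] at hl ⊢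
    grind

theorem StdConnected.isSwap {α : Type*} [DecidableEq α] {l l' : List (Perm α)}
    (h : StdConnected l l') (hl : ∀ τ ∈ l, τ.IsSwap) : ∀ τ ∈ l', τ.IsSwap := by
  induction h with
  | refl => exact hl
  | tail _ h ih => exact h.isSwap ih

theorem swap_conj_of_ne {α : Type*} [DecidableEq α] {a b x : α} (hxa : x ≠ a) (hxb : x ≠ b) :
    swap a b * swap x a * (swap a b)⁻¹ = swap x b := by
  rw [← swap_apply_apply, swap_apply_of_ne_of_ne hxa hxb, swap_apply_left]

/-- Any transposition of two points in the same cycle of the product of a list of transpositions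
can be moved to the front of the list. -/
theorem exists_stdConnected_swap_cons {α : Type*} [Finite α] [DecidableEq α]
    (l : List (Perm α)) (hl : ∀ τ ∈ l, τ.IsSwap) {x y : α} (hxy : x ≠ y)
    (h : l.prod.SameCycle x y) : ∃ m, StdConnected l (swap x y :: m) := by
  induction hr : l.length using Nat.strong_induction_on generalizing l x y with
  | _ r ih =>
  match l with
  | [] => simp [hxy] at h
  | τ :: m =>
    obtain ⟨a, b, hab, rfl⟩ := hl τ (by simp)
    have hm : ∀ τ ∈ m, τ.IsSwap := fun τ hτ => hl τ (by simp [hτ])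
    simp only [List.length_cons] at hr
    have bring {u v : α} (huv : u ≠ v) (h : m.prod.SameCycle u v) :
        ∃ m', StdConnected m (swap u v :: m') := ih m.length (by lia) m hm huv h rfl
    rw [List.prod_cons] at h
    by_cases hρ : m.prod.SameCycle x y
    · obtain ⟨m', hm'⟩ := bring hxy hρ
      exact ⟨_, (hm'.cons _).trans (StdConnected.swap_right _ _ _)⟩
    have across {a b : α} (hxa : m.prod.SameCycle x a) (hyb : m.prod.SameCycle y b) :
        ∃ m', StdConnected (swap a b :: m) (swap x y :: m') := by
      have hxb : ¬ m.prod.SameCycle x b := fun h => hρ (h.trans hyb.symm)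
      have hya : ¬ m.prod.SameCycle y a := fun h => hρ (hxa.trans h.symm)
      have nxb : x ≠ b := by rintro rfl; exact hxb (SameCycle.refl _ _)
      have nya : y ≠ a := by rintro rfl; exact hya (SameCycle.refl _ _)
      by_cases nxa : x = a
      · subst nxa
        by_cases nyb : y = b
        · subst nyb
          exact ⟨m, Relation.ReflTransGen.refl⟩
        obtain ⟨m', hm'⟩ := bring nyb hyb
        rw [swap_comm x b]
        have := (hm'.cons (swap b x)).trans (StdConnected.swap_left _ _ _)
        rw [swap_conj_of_ne nyb hxy.symm, swap_comm y x] at this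
        exact ⟨_, this⟩
      obtain ⟨m', hm'⟩ := bring nxa hxa
      have h₁ : StdConnected (swap a b :: m) (swap x b :: swap a b :: m') := by
        have := StdConnected.swap_left (swap a b) (swap x a) m'
        rw [swap_conj_of_ne nxa nxb] at this
        exact (hm'.cons _).trans this
      by_cases nyb : y = b
      · subst nyb
        exact ⟨_, h₁⟩
      have hlen := hm'.length_eq
      simp only [List.length_cons] at hlen
      have hprod : m'.prod = swap x a * m.prod := by
        rw [← hm'.prod_eq, List.prod_cons, swap_mul_self_mul]
      have hyb' : m'.prod.SameCycle y b := by
        rw [hprod]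
        exact hyb.swap_mul_of_disjoint (fun h => hρ h.symm) hya
      obtain ⟨m'', hm''⟩ := ih m'.length (by lia) m'
        (fun τ hτ => hm'.isSwap hm τ (by simp [hτ])) nyb hyb' rfl
      have h₂ : StdConnected _ _ := (hm''.cons (swap a b)).trans (StdConnected.swap_right _ _ _)
      have h₃ := (h₁.trans (h₂.cons (swap x b))).trans (StdConnected.swap_left _ _ _)
      rw [swap_comm x b, swap_conj_of_ne nyb hxy.symm, swap_comm y x] at h₃
      exact ⟨_, h₃⟩
    rcases h.of_swap_mul with h | ⟨hxa, hyb⟩ | ⟨hxb, hya⟩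
    · exact absurd h hρ
    · exact across hxa hyb
    · rw [swap_comm]
      exact across hxb hya

theorem stdConnected_of_forall_length_le {α : Type*} [Finite α] [DecidableEq α]
    (l l' : List (Perm α)) (hl : ∀ τ ∈ l, τ.IsSwap) (hl' : ∀ τ ∈ l', τ.IsSwap)
    (hlen : l.length = l'.length) (hprod : l.prod = l'.prod)
    (hmin : ∀ k : List (Perm α), (∀ τ ∈ k, τ.IsSwap) → k.prod = l'.prod →
      l'.length ≤ k.length) : StdConnected l l' := by
  induction l' generalizing l with
  | nil =>
    rw [List.length_eq_zero_iff.1 hlen]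
    exact Relation.ReflTransGen.refl
  | cons τ m' ih =>
    have hτ := hl' τ (by simp)
    have hm' : ∀ τ ∈ m', τ.IsSwap := fun τ hτ => hl' τ (by simp [hτ])
    obtain ⟨a, b, hab, rfl⟩ := id hτ
    have hnot : ¬ m'.prod.SameCycle a b := by
      intro h
      obtain ⟨k, hk⟩ := exists_stdConnected_swap_cons m' hm' hab h
      have h₁ := hmin k (fun τ hτ => hk.isSwap hm' τ (by simp [hτ]))
        (by rw [List.prod_cons, ← hk.prod_eq, List.prod_cons, swap_mul_self_mul])
      have h₂ := hk.length_eq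
      simp only [List.length_cons] at h₁ h₂
      lia
    have hcyc : l.prod.SameCycle a b := by
      rw [hprod, List.prod_cons]
      exact SameCycle.swap_mul_of_not hnot
    obtain ⟨m, hm⟩ := exists_stdConnected_swap_cons l hl hab hcyc
    refine Relation.ReflTransGen.trans hm (StdConnected.cons _ (ih m ?_ hm' ?_ ?_ ?_))
    · exact fun τ hτ => hm.isSwap hl τ (by simp [hτ])
    · have := hm.length_eq
      simp only [List.length_cons] at this hlen
      lia
    · have := hm.prod_eq.trans hprod
      simpa using this
    · intro k hk hkp
      have := hmin (swap a b :: k) (by simpa using ⟨hτ, hk⟩) (by simp [hkp])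
      simpa using this

/-- The geodesic PMQ `S_n^geo` is coconnected: any two minimal-length decompositions of a
permutation `σ` into transpositions are connected by standard moves. -/
theorem stdConnected_of_minimal_decompositions (n : ℕ) (σ : Equiv.Perm (Fin n))
    (l l' : List (Equiv.Perm (Fin n)))
    (hswap : ∀ τ ∈ l, τ.IsSwap) (hswap' : ∀ τ ∈ l', τ.IsSwap)
    (hlen : l.length = permNorm σ) (hlen' : l'.length = permNorm σ)
    (hprod : l.prod = σ) (hprod' : l'.prod = σ) :
    StdConnected l l' := by
  refine stdConnected_of_forall_length_le l l' hswap hswap' (hlen.trans hlen'.symm)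
    (hprod.trans hprod'.symm) fun k hk hkp => ?_
  rw [hlen']
  exact Nat.sInf_le ⟨k, hk, hkp.trans hprod', rfl⟩
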